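/- Let f ∈ S be a reduced homogeneous polynomial of degree d defining a plane curve which is not a union of lines through one point, and suppose dim_ℂ N(f)_k ≤ 1 for every integer k. Then the Jacobian module N(f) = I_f/J_f is a cyclic S-module, i.e. there exists an element e ∈ N(f) with N(f) = S·e. -/

import Mathlib

open MvPolynomial

noncomputable section

/-- The polynomial ring `S = ℂ[x,y,z]`. -/
abbrev S : Type := MvPolynomial (Fin 3) ℂ

/-- The Jacobian ideal of `f`, spanned by the three partial derivatives. -/
def Jf (f : S) : Ideal S := Ideal.span {pderiv 0 f, pderiv 1 f, pderiv 2 f}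

/-- The irrelevant maximal ideal `m = (x,y,z)`. -/
def mId : Ideal S := Ideal.span {X 0, X 1, X 2}

/-- The saturation `I_f` of the Jacobian ideal with respect to `m`. -/
def Isat (f : S) : Ideal S := ⨆ n : ℕ, Submodule.colon (Jf f) ((mId ^ n : Ideal S) : Submodule S S)

/-- The quotient map `S → M(f) = S/J_f`, as a `ℂ`-linear map. -/
def quotC (f : S) : S →ₗ[ℂ] (S ⧸ (Jf f : Submodule S S)) :=
  ((Jf f : Submodule S S).mkQ).restrictScalars ℂ

/-- Degree-`k` homogeneous component of `S`, as a `ℂ`-subspace. -/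
def Sgr (k : ℕ) : Submodule ℂ S := homogeneousSubmodule (Fin 3) ℂ k

/-- The degree-`k` part of the Milnor algebra `M(f)`. -/
def Msub (f : S) (k : ℕ) : Submodule ℂ (S ⧸ (Jf f : Submodule S S)) := (Sgr k).map (quotC f)

/-- `m(f)_k`, the dimension of the degree-`k` part of the Milnor algebra. -/
def mdim (f : S) (k : ℕ) : ℕ := Module.finrank ℂ (Msub f k)

/-- The degree-`k` part of the Jacobian module `N(f) = I_f/J_f`, realized inside `S/J_f`. -/
def Nsub (f : S) (k : ℕ) : Submodule ℂ (S ⧸ (Jf f : Submodule S S)) :=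
  (((Isat f).restrictScalars ℂ) ⊓ Sgr k).map (quotC f)

/-- `dim_ℂ N(f)_k`. -/
def ndim (f : S) (k : ℕ) : ℕ := Module.finrank ℂ (Nsub f k)

/-- The Jacobian module `N(f) = I_f/J_f`, as an `S`-submodule of `S/J_f`. -/
def Nmod (f : S) : Submodule S (S ⧸ (Jf f : Submodule S S)) :=
  Submodule.map ((Jf f : Submodule S S).mkQ) (Isat f : Submodule S S)

/-- The Jacobian module `N(f)` as a `ℂ`-subspace of `S/J_f`. -/
def NsubTot (f : S) : Submodule ℂ (S ⧸ (Jf f : Submodule S S)) :=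
  ((Isat f).restrictScalars ℂ).map (quotC f)

/-- `dim_ℂ N(f)`. -/
def ndimTot (f : S) : ℕ := Module.finrank ℂ (NsubTot f)

/-- `C : f = 0` is nearly free: `N(f) ≠ 0` and `dim N(f)_k ≤ 1` for all `k`. -/
def NearlyFree (f : S) : Prop := Nmod f ≠ ⊥ ∧ ∀ k : ℕ, ndim f k ≤ 1

/-- `f` defines a union of lines passing through one point. -/
def IsConeOfLines (f : S) : Prop :=
  ∃ q : Fin 3 → ℂ, q ≠ 0 ∧ ∃ (c : ℂ) (L : Multiset S),
    (∀ l ∈ L, l ∈ Sgr 1 ∧ eval q l = 0) ∧ f = C c * L.prod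

/-- The defining equation map `(a,b,c) ↦ a f_x + b f_y + c f_z`. -/
def eqnMap (f : S) : (Fin 3 → S) →ₗ[S] S where
  toFun r := ∑ i, r i * pderiv i f
  map_add' a b := by simp [add_mul, Finset.sum_add_distrib]
  map_smul' c a := by simp [Finset.mul_sum, mul_assoc]

/-- `AR(f)`, the module of all relations among the partial derivatives of `f`. -/
def ARmod (f : S) : Submodule S (Fin 3 → S) := LinearMap.ker (eqnMap f)

/-- A triple of polynomials is homogeneous of degree `m` (componentwise). -/
def IsHomRel (r : Fin 3 → S) (m : ℕ) : Prop := ∀ i, r i ∈ Sgr m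

/-- The set of degrees of nonzero homogeneous relations in `AR(f)`;
its least element is `mdr(f)`. -/
def mdrSet (f : S) : Set ℕ := {m | ∃ r ∈ ARmod f, r ≠ 0 ∧ IsHomRel r m}

/-- The map `(u₁,u₂,u₃) ↦ u₁ r₁ + u₂ r₂ + u₃ r₃` whose kernel is the syzygy
module among `r₁, r₂, r₃`. -/
def syzMap (r : Fin 3 → (Fin 3 → S)) : (Fin 3 → S) →ₗ[S] (Fin 3 → S) where
  toFun u := ∑ j, u j • r j
  map_add' a b := by simp [add_smul, Finset.sum_add_distrib]
  map_smul' c a := by simp [Finset.smul_sum, smul_smul]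

/-- `M(f)` has a minimal graded free resolution
`0 → S(−b−2(d−1)) → ⊕ᵢ S(−dᵢ−(d−1)) → S(−d+1)³ → S`; equivalently, `AR(f)` is
generated by three homogeneous relations of degrees `d₁, d₂, d₃`, none lying in
the submodule spanned by the other two, whose syzygy module is free of rank one,
generated by a homogeneous triple `(v₁,v₂,v₃)` with `deg vᵢ = b − dᵢ + d − 1`. -/
def HasResolution (f : S) (d : ℕ) (dd : Fin 3 → ℕ) (b : ℤ) : Prop :=
  ∃ r : Fin 3 → (Fin 3 → S),
    (∀ j, r j ∈ ARmod f) ∧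
    (∀ j, IsHomRel (r j) (dd j)) ∧
    Submodule.span S (Set.range r) = ARmod f ∧
    (∀ j, r j ∉ Submodule.span S (r '' {k | k ≠ j})) ∧
    ∃ v : Fin 3 → S, v ≠ 0 ∧
      (∀ j, ∃ e : ℕ, (e : ℤ) = b - dd j + d - 1 ∧ v j ∈ Sgr e) ∧
      LinearMap.ker (syzMap r) = Submodule.span S {v}

/-- The Hilbert function of the Milnor algebra of a smooth plane curve of
degree `d`: the coefficient of `t^k` in `((1 − t^{d−1})/(1 − t))³`. -/
def msHilb (d k : ℕ) : ℕ :=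
  (((∑ i ∈ Finset.range (d - 1), (Polynomial.X : Polynomial ℕ) ^ i)) ^ 3).coeff k

/-- `τ` is the total Tjurina number of `C : f = 0`, i.e. the common value of
`m(f)_k` for all sufficiently large `k`. -/
def TjurinaIs (f : S) (τ : ℕ) : Prop := ∃ N : ℕ, ∀ k ≥ N, mdim f k = τ



theorem mId_eq : mId = Ideal.span (X '' (Set.univ : Set (Fin 3))) := by
  unfold mId
  congr 1
  ext p
  simp only [Set.mem_insert_iff, Set.mem_singleton_iff, Set.image_univ, Set.mem_range,
    Fin.exists_fin_succ, Fin.exists_fin_zero]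
  simp [eq_comm]

theorem mem_mId_iff (p : S) : p ∈ mId ↔ coeff 0 p = 0 := by
  rw [mId_eq, mem_ideal_span_X_image]
  constructor
  · intro h
    by_contra hc
    obtain ⟨i, -, hi⟩ := h 0 (by simpa [mem_support_iff] using hc)
    simp at hi
  · intro h m hm
    by_contra hc
    push Not at hc
    have : m = 0 := by
      ext i
      simpa using hc i (Set.mem_univ _)
    subst this
    exact (mem_support_iff.1 hm) h

theorem mId_eq_ker : mId = RingHom.ker (constantCoeff : S →+* ℂ) := by
  ext p
  rw [mem_mId_iff, RingHom.mem_ker, constantCoeff_eq]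

instance mId_max : mId.IsMaximal := by
  rw [mId_eq_ker]
  exact RingHom.ker_isMaximal_of_surjective _ (fun c => ⟨C c, by simp⟩)

theorem X_mem_mId (i : Fin 3) : (X i : S) ∈ mId := by
  rw [mem_mId_iff]; simp

theorem three_le_height : (3 : ℕ∞) ≤ mId.height := by
  let φ1 : S →ₐ[ℂ] S := aeval ![0, X 1, X 2]
  let φ2 : S →ₐ[ℂ] S := aeval ![0, 0, X 2]
  let φ3 : S →ₐ[ℂ] S := aeval ![0, 0, 0]
  have h21 : φ2.comp φ1 = φ2 := by
    apply MvPolynomial.algHom_ext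
    intro i
    fin_cases i <;> simp [φ1, φ2]
  have h32 : φ3.comp φ2 = φ3 := by
    apply MvPolynomial.algHom_ext
    intro i
    fin_cases i <;> simp [φ2, φ3]
  have p1 : (RingHom.ker φ1).IsPrime := RingHom.ker_isPrime _
  have p2 : (RingHom.ker φ2).IsPrime := RingHom.ker_isPrime _
  have p3 : (RingHom.ker φ3).IsPrime := RingHom.ker_isPrime _
  have l0 : (⊥ : Ideal S) < RingHom.ker φ1 := by
    rw [bot_lt_iff_ne_bot]
    intro h
    have : (X 0 : S) ∈ RingHom.ker φ1 := by simp [RingHom.mem_ker, φ1]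
    rw [h] at this
    simp at this
  have l1 : RingHom.ker φ1 < RingHom.ker φ2 := by
    refine lt_of_le_of_ne ?_ ?_
    · intro p hp
      rw [RingHom.mem_ker] at hp ⊢
      rw [← h21, AlgHom.comp_apply, hp, map_zero]
    · intro h
      have : (X 1 : S) ∈ RingHom.ker φ2 := by simp [RingHom.mem_ker, φ2]
      rw [← h] at this
      simp [RingHom.mem_ker, φ1] at this
  have l2 : RingHom.ker φ2 < RingHom.ker φ3 := by
    refine lt_of_le_of_ne ?_ ?_
    · intro p hp
      rw [RingHom.mem_ker] at hp ⊢
      rw [← h32, AlgHom.comp_apply, hp, map_zero]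
    · intro h
      have : (X 2 : S) ∈ RingHom.ker φ3 := by simp [RingHom.mem_ker, φ3]
      rw [← h] at this
      simp [RingHom.mem_ker, φ2] at this
  have h3 : RingHom.ker φ3 = mId := by
    symm
    apply mId_max.eq_of_le p3.ne_top
    rw [mId, Ideal.span_le]
    rintro p (rfl | rfl | rfl) <;> simp [RingHom.mem_ker, φ3]
  rw [← h3]
  have q0 := Ideal.height_add_one_le_of_lt_of_isPrime l0
  have q1 := Ideal.height_add_one_le_of_lt_of_isPrime l1
  have q2 := Ideal.height_add_one_le_of_lt_of_isPrime l2
  calc (3 : ℕ∞) = 0 + 1 + 1 + 1 := by norm_num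
    _ ≤ (⊥ : Ideal S).height + 1 + 1 + 1 := by gcongr; simp
    _ ≤ (RingHom.ker φ1).height + 1 + 1 := by gcongr
    _ ≤ (RingHom.ker φ2).height + 1 := by gcongr
    _ ≤ _ := q2

theorem krull_two (A : Ideal S) (hA : A ≠ ⊤) (p : ℕ) (hp : mId ^ p ≤ A) (a b : S)
    (ha : a ∈ A) (hb : b ∈ A) : ¬ A ≤ Ideal.span {a, b} ⊔ mId * A := by
  intro hle
  have hAm : A ≤ mId := by
    obtain ⟨M, hM, hAM⟩ := Ideal.exists_le_maximal A hA
    have h1 : mId ≤ M := (Ideal.IsPrime.pow_le_iff (by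
      rintro rfl
      simp at hp
      exact hA hp)).1 (hp.trans hAM)
    rwa [← mId_max.eq_of_le hM.ne_top h1] at hAM
  obtain ⟨r, hr, hrA⟩ := Submodule.exists_sub_one_mem_and_smul_le_of_fg_of_le_sup
    (I := mId) (N := Ideal.span {a, b}) (N' := A) (P := A) (IsNoetherian.noetherian A) le_rfl
      (by simpa using hle)
  have hrm : r ∉ mId := by
    intro h
    apply mId_max.ne_top
    rw [Ideal.eq_top_iff_one]
    have := sub_mem h hr
    simpa using this
  have hmin : mId ∈ (Ideal.span {a, b}).minimalPrimes := by
    refine ⟨⟨inferInstance, ?_⟩, ?_⟩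
    · rw [Ideal.span_le]
      rintro x (rfl | rfl)
      · exact hAm ha
      · exact hAm hb
    · rintro P ⟨hP, hPle⟩ hPm
      have hAP : A ≤ P := by
        intro x hx
        have : r * x ∈ P := hPle (hrA (Submodule.smul_mem_pointwise_smul x r A hx))
        exact (hP.mem_or_mem this).resolve_left (fun h => hrm (hPm h))
      exact (Ideal.IsPrime.pow_le_iff (by
        rintro rfl
        simp at hp
        exact hA hp)).1 (hp.trans hAP)
  have h2 := Ideal.height_le_spanRank_toENat_of_mem_minimalPrimes _ _ hmin
  have h3 : Submodule.spanRank (Ideal.span {a, b} : Ideal S) ≤ 2 := by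
    refine (Submodule.spanRank_span_le_card _).trans ?_
    refine (Cardinal.mk_insert_le).trans ?_
    rw [Cardinal.mk_singleton]; norm_num
  have h4 := (three_le_height.trans h2).trans (Cardinal.toENat.monotone' h3)
  have : (3 : ℕ∞) ≤ 2 := by simpa using h4
  exact absurd this (by decide)

theorem triple (A : Ideal S) (hA : A ≠ ⊤) (p : ℕ) (hp : mId ^ p ≤ A) :
    ∃ c : Fin 3 → S, (∀ j, c j ∈ A) ∧
      ∀ l : Fin 3 → ℂ, (∑ j, C (l j) * c j) ∈ mId * A → l = 0 := by
  have key := krull_two A hA p hp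
  obtain ⟨a, ha, ha'⟩ := SetLike.not_le_iff_exists.1 (key 0 0 A.zero_mem A.zero_mem)
  obtain ⟨b, hb, hb'⟩ := SetLike.not_le_iff_exists.1 (key a a ha ha)
  obtain ⟨c, hc, hc'⟩ := SetLike.not_le_iff_exists.1 (key a b ha hb)
  have inv : ∀ (t : ℂ) (u : S) (Q : Ideal S), t ≠ 0 → C t * u ∈ Q → u ∈ Q := by
    intro t u Q ht h
    have := Q.mul_mem_left (C t⁻¹) h
    rwa [← mul_assoc, ← C_mul, inv_mul_cancel₀ ht, C_1, one_mul] at this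
  refine ⟨![a, b, c], ?_, ?_⟩
  · intro j; fin_cases j <;> simp [ha, hb, hc]
  · intro l hl
    simp [Fin.sum_univ_three] at hl
    have e2 : l 2 = 0 := by
      by_contra h
      apply hc'
      refine inv _ _ _ h ?_
      have h1 : C (l 0) * a + C (l 1) * b ∈ Ideal.span {a, b} :=
        add_mem (Ideal.mul_mem_left _ _ (Ideal.subset_span (by simp)))
          (Ideal.mul_mem_left _ _ (Ideal.subset_span (by simp)))
      have := sub_mem (Ideal.mem_sup_right (S := Ideal.span {a, b}) hl) (Ideal.mem_sup_left (T := mId * A) h1)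
      simpa using this
    rw [e2] at hl
    have e1 : l 1 = 0 := by
      by_contra h
      apply hb'
      refine inv _ _ _ h ?_
      have h1 : C (l 0) * a ∈ Ideal.span {a, a} :=
        (Ideal.mul_mem_left _ _ (Ideal.subset_span (by simp)))
      have := sub_mem (Ideal.mem_sup_right (S := Ideal.span {a, a}) hl) (Ideal.mem_sup_left (T := mId * A) h1)
      simpa using this
    rw [e1] at hl
    have e0 : l 0 = 0 := by
      by_contra h
      apply ha'
      refine inv _ _ _ h ?_
      apply Ideal.mem_sup_right
      simpa using hl
    funext j; fin_cases j <;> simp [e0, e1, e2]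

theorem inter_aux (s : Set (Fin 3)) (t : Fin 3) (c : S)
    (h : ∀ k : ℕ, ∃ w v : S, w ∈ Ideal.span (X '' s : Set S) ∧ c = w + X t ^ k * v) :
    c ∈ Ideal.span (X '' s : Set S) := by
  rw [mem_ideal_span_X_image]
  intro m hm
  obtain ⟨w, v, hw, hc⟩ := h (m t + 1)
  rw [mem_ideal_span_X_image] at hw
  apply hw
  rw [mem_support_iff] at hm ⊢
  rw [hc, coeff_add] at hm
  have : coeff m (X t ^ (m t + 1) * v) = 0 := by
    rw [X_pow_eq_monomial, coeff_monomial_mul', if_neg]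
    intro hle
    have := hle t
    simp at this
  rwa [this, add_zero] at hm

/-- One descent step. -/
theorem descent {M κ : Type*} [AddCommGroup M] [Module S M] [Fintype κ] (s : Set (Fin 3)) (t : Fin 3)
    (Q : Submodule S M) (u : κ → M)
    (hQ : ∀ i ∈ s, ∀ k, (X i : S) • u k ∈ Q)
    (hreg : ∀ c : κ → S, (X t : S) • (∑ k, c k • u k) ∈ Q → ∑ k, c k • u k ∈ Q)
    (h : ∀ c : κ → S, ∑ k, c k • u k ∈ Q → ∀ k, c k ∈ Ideal.span (X '' (insert t s) : Set S)) :
    ∀ c : κ → S, ∑ k, c k • u k ∈ Q → ∀ k, c k ∈ Ideal.span (X '' s : Set S) := by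
  intro c hc k
  apply inter_aux s t
  have hw : ∀ (w : S) (k : κ), w ∈ Ideal.span (X '' s : Set S) → w • u k ∈ Q := by
    intro w k hw
    have : Ideal.span (X '' s : Set S) ≤ Submodule.comap (LinearMap.toSpanSingleton S M (u k)) Q := by
      rw [Ideal.span_le]
      rintro _ ⟨i, hi, rfl⟩
      exact hQ i hi k
    exact this hw
  have main : ∀ n : ℕ, ∃ w v : κ → S, (∀ k, w k ∈ Ideal.span (X '' s : Set S)) ∧
      (∀ k, c k = w k + X t ^ n * v k) ∧ ∑ k, v k • u k ∈ Q := by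
    intro n
    induction n with
    | zero => exact ⟨0, c, by simp, by simp, hc⟩
    | succ n ih =>
      obtain ⟨w, v, h1, h2, h3⟩ := ih
      have h4 := h v h3
      have h5 : ∀ k, ∃ a b : S, a ∈ Ideal.span (X '' s : Set S) ∧ v k = a + X t * b := by
        intro k
        have := h4 k
        rw [Set.image_insert_eq, Ideal.mem_span_insert] at this
        obtain ⟨b, a, ha, e⟩ := this
        exact ⟨a, b, ha, by rw [e]; ring⟩
      choose a b ha hb using h5
      refine ⟨fun k => w k + X t ^ n * a k, b, ?_, ?_, ?_⟩
      · intro k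
        exact add_mem (h1 k) (Ideal.mul_mem_left _ _ (ha k))
      · intro k
        rw [h2, hb]; ring
      · apply hreg
        have e : (X t : S) • (∑ k, b k • u k) = ∑ k, v k • u k - ∑ k, a k • u k := by
          rw [Finset.smul_sum, ← Finset.sum_sub_distrib]
          refine Finset.sum_congr rfl fun k _ => ?_
          rw [hb k, smul_smul, ← sub_smul]
          congr 1; ring
        rw [e]
        exact sub_mem h3 (Submodule.sum_mem _ fun k _ => hw _ _ (ha k))
  intro n
  obtain ⟨w, v, h1, h2, -⟩ := main n
  exact ⟨w k, v k, h1 k, h2 k⟩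

theorem dvd_two (i j : Fin 3) (hij : i ≠ j) (a b : S) (h : X i * a + X j * b = 0) :
    ∃ r, a = X j * r ∧ b = - (X i * r) := by
  have hp : Prime (X j : S) := X_prime
  have hd : (X j : S) ∣ X i * a := ⟨-b, by linear_combination h⟩
  have hn : ¬ (X j : S) ∣ X i := by
    rw [X_dvd_X]; simpa using hij.symm
  obtain ⟨r, rfl⟩ := (hp.dvd_or_dvd hd).resolve_left hn
  refine ⟨r, rfl, ?_⟩
  apply mul_left_cancel₀ hp.ne_zero
  linear_combination h

theorem dvd_two_vec {ι : Type*} (i j : Fin 3) (hij : i ≠ j) (a b : ι → S)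
    (h : (X i : S) • a + (X j : S) • b = 0) :
    ∃ r : ι → S, a = (X j : S) • r ∧ b = - ((X i : S) • r) := by
  have : ∀ k, ∃ r, a k = X j * r ∧ b k = - (X i * r) := fun k =>
    dvd_two i j hij (a k) (b k) (by simpa using congrFun h k)
  choose r h1 h2 using this
  exact ⟨r, by ext1 k; simp [h1], by ext1 k; simp [h2]⟩

theorem mem_xy (a b c : S) (h : X 2 * a = X 0 * b + X 1 * c) : ∃ p q, a = X 0 * p + X 1 * q := by
  have h1 : a ∈ Ideal.span (X '' ({0, 1} : Set (Fin 3)) : Set S) := by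
    have h2 : X 2 * a ∈ Ideal.span (X '' ({0, 1} : Set (Fin 3)) : Set S) := by
      rw [h]
      exact add_mem (Ideal.mul_mem_right _ _ (Ideal.subset_span ⟨0, by simp, rfl⟩))
        (Ideal.mul_mem_right _ _ (Ideal.subset_span ⟨1, by simp, rfl⟩))
    rw [mem_ideal_span_X_image] at h2 ⊢
    intro m hm
    obtain ⟨i, hi, hi'⟩ := h2 (Finsupp.single 2 1 + m) (by
      rw [mem_support_iff] at hm ⊢
      rwa [coeff_X_mul])
    refine ⟨i, hi, ?_⟩
    have : i ≠ 2 := by rintro rfl; simp at hi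
    rw [Finsupp.add_apply, Finsupp.single_eq_of_ne this] at hi'
    simpa using hi'
  rw [Set.image_pair, Ideal.mem_span_pair] at h1
  obtain ⟨p, q, e⟩ := h1
  exact ⟨p, q, by rw [← e]; ring⟩

theorem mem_xy_vec {ι : Type*} (a b c : ι → S)
    (h : (X 2 : S) • a = (X 0 : S) • b + (X 1 : S) • c) :
    ∃ p q : ι → S, a = (X 0 : S) • p + (X 1 : S) • q := by
  have : ∀ k, ∃ p q, a k = X 0 * p + X 1 * q := fun k =>
    mem_xy (a k) (b k) (c k) (by simpa using congrFun h k)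
  choose p q h1 using this
  exact ⟨p, q, by ext1 k; simp [h1]⟩

theorem depth_indep {ι κ : Type*} [Fintype κ] (φ : (ι → S) →ₗ[S] S)
    (hsat : ∀ h : S, (∀ i, X i * h ∈ LinearMap.range φ) → h ∈ LinearMap.range φ)
    (u : κ → ι → S) (hu : ∀ k, φ (u k) = 0)
    (hind : ∀ l : κ → ℂ, (∃ p q r : ι → S, φ p = 0 ∧ φ q = 0 ∧ φ r = 0 ∧
      ∑ k, (C (l k) : S) • u k = (X 0 : S) • p + (X 1 : S) • q + (X 2 : S) • r) → l = 0) :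
    LinearIndependent S u := by
  classical
  let Q1 : Submodule S (ι → S) := (LinearMap.ker φ).map (LinearMap.lsmul S (ι → S) (X 0))
  let Q2 : Submodule S (ι → S) := Q1 ⊔ (LinearMap.ker φ).map (LinearMap.lsmul S (ι → S) (X 1))
  have mQ1 : ∀ v, v ∈ Q1 ↔ ∃ p, φ p = 0 ∧ v = (X 0 : S) • p := by
    intro v
    simp [Q1, Submodule.mem_map, eq_comm]
  have mQ2 : ∀ v, v ∈ Q2 ↔ ∃ p q, φ p = 0 ∧ φ q = 0 ∧ v = (X 0 : S) • p + (X 1 : S) • q := by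
    intro v
    simp only [Q2, Submodule.mem_sup, mQ1, Submodule.mem_map, LinearMap.mem_ker,
      LinearMap.lsmul_apply]
    constructor
    · rintro ⟨_, ⟨p, hp, rfl⟩, _, ⟨q, hq, rfl⟩, rfl⟩
      exact ⟨p, q, hp, hq, rfl⟩
    · rintro ⟨p, q, hp, hq, rfl⟩
      exact ⟨_, ⟨p, hp, rfl⟩, _, ⟨q, hq, rfl⟩, rfl⟩
  have hsum : ∀ c : κ → S, φ (∑ k, c k • u k) = 0 := by
    intro c
    simp [hu]
  -- step 2
  have s2 : ∀ c : κ → S, ∑ k, c k • u k ∈ Q2 →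
      ∀ k, c k ∈ Ideal.span (X '' ({0, 1} : Set (Fin 3)) : Set S) := by
    apply descent {0, 1} 2 Q2 u
    · rintro i (rfl | rfl) k
      · exact (mQ2 _).2 ⟨u k, 0, hu k, by simp, by simp⟩
      · exact (mQ2 _).2 ⟨0, u k, by simp, hu k, by simp⟩
    · intro c hc
      have hU := hsum c
      generalize ∑ k, c k • u k = U at hc hU ⊢
      obtain ⟨v, w, hv, hw, e⟩ := (mQ2 _).1 hc
      obtain ⟨p, q, e2⟩ := mem_xy_vec U v w e
      obtain ⟨r, e3, e4⟩ := dvd_two_vec 0 1 (by decide) (v - (X 2 : S) • p) (w - (X 2 : S) • q) (by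
        have : (X 0 : S) • v + (X 1 : S) • w - (X 2 : S) • U = 0 := by rw [e]; simp
        rw [e2] at this
        rw [← this]
        module)
      have f1 : X 0 * φ p + X 1 * φ q = 0 := by
        rw [e2] at hU; simpa using hU
      obtain ⟨h, g1, g2⟩ := dvd_two 0 1 (by decide) _ _ f1
      have f2 : φ r = - (X 2 * h) := by
        have := congrArg φ e3
        simp only [map_sub, map_smul, hv, smul_eq_mul, g1] at this
        apply mul_left_cancel₀ (X_ne_zero (R := ℂ) (1 : Fin 3))
        linear_combination -this
      obtain ⟨t, ht⟩ := hsat h (by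
        intro i
        fin_cases i
        · exact ⟨-q, by simp [g2]⟩
        · exact ⟨p, by simp [g1]⟩
        · exact ⟨-r, by simp [f2]⟩)
      refine (mQ2 _).2 ⟨p - (X 1 : S) • t, q + (X 0 : S) • t, ?_, ?_, ?_⟩
      · simp [ht, g1]
      · simp [ht, g2]
      · rw [e2]; module
    · intro c hc k
      have hset : (insert 2 ({0, 1} : Set (Fin 3))) = Set.univ := by
        ext i; fin_cases i <;> simp
      rw [hset, ← mId_eq, mem_mId_iff]
      have := hind (fun k => coeff 0 (c k)) ?_
      · exact congrFun this k
      obtain ⟨p, q, hp, hq, e⟩ := (mQ2 _).1 hc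
      have dec : ∀ k, ∃ a b d : S, c k = C (coeff 0 (c k)) + X 0 * a + X 1 * b + X 2 * d := by
        intro k
        have : c k - C (coeff 0 (c k)) ∈ mId := by rw [mem_mId_iff]; simp
        rw [mId, Ideal.mem_span_insert] at this
        obtain ⟨a, z, hz, e⟩ := this
        rw [Ideal.mem_span_pair] at hz
        obtain ⟨b, d, rfl⟩ := hz
        exact ⟨a, b, d, by linear_combination e⟩
      choose a b d hdec using dec
      refine ⟨p - ∑ k, a k • u k, q - ∑ k, b k • u k, - ∑ k, d k • u k, ?_, ?_, ?_, ?_⟩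
      · simp [hp, hu]
      · simp [hq, hu]
      · simp [hu]
      · have e' : ∑ k, c k • u k = ∑ k, (C (coeff 0 (c k)) : S) • u k + (X 0 : S) • ∑ k, a k • u k
            + (X 1 : S) • ∑ k, b k • u k + (X 2 : S) • ∑ k, d k • u k := by
          simp only [Finset.smul_sum, ← Finset.sum_add_distrib]
          refine Finset.sum_congr rfl fun k _ => ?_
          conv_lhs => rw [hdec k]
          module
        rw [e] at e'
        have e'' := eq_sub_of_add_eq (eq_sub_of_add_eq (eq_sub_of_add_eq e'.symm))
        rw [e'']
        module
  have s1 : ∀ c : κ → S, ∑ k, c k • u k ∈ Q1 →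
      ∀ k, c k ∈ Ideal.span (X '' ({0} : Set (Fin 3)) : Set S) := by
    apply descent {0} 1 Q1 u
    · rintro i rfl k
      exact (mQ1 _).2 ⟨u k, hu k, rfl⟩
    · intro c hc
      have hU := hsum c
      generalize ∑ k, c k • u k = U at hc hU ⊢
      obtain ⟨v, hv, e⟩ := (mQ1 _).1 hc
      obtain ⟨r, e3, e4⟩ := dvd_two_vec 1 0 (by decide) U (-v) (by rw [e]; simp)
      refine (mQ1 _).2 ⟨r, ?_, e3⟩
      rw [e3] at hU
      simpa using hU
    · intro c hc k
      rw [Set.pair_comm]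
      exact s2 c (Submodule.mem_sup_left hc) k
  have s0 : ∀ c : κ → S, ∑ k, c k • u k ∈ (⊥ : Submodule S (ι → S)) →
      ∀ k, c k ∈ Ideal.span (X '' (∅ : Set (Fin 3)) : Set S) := by
    apply descent ∅ 0 ⊥ u
    · simp
    · intro c hc
      rw [Submodule.mem_bot] at hc ⊢
      exact (smul_eq_zero.1 hc).resolve_left (X_ne_zero _)
    · intro c hc k
      have := s1 c (bot_le (a := Q1) hc) k
      simpa using this
  rw [Fintype.linearIndependent_iff]
  intro c hc k
  have := s0 c (by simpa using hc) k
  simpa using this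

theorem card_bound {ι κ : Type*} [Fintype ι] [Fintype κ] (φ : (ι → S) →ₗ[S] S)
    (hne : φ ≠ 0) (u : κ → ι → S) (hu : ∀ k, φ (u k) = 0) (hli : LinearIndependent S u) :
    Fintype.card κ + 1 ≤ Fintype.card ι := by
  obtain ⟨v, hv⟩ : ∃ v, φ v ≠ 0 := by
    by_contra h
    push Not at h
    exact hne (LinearMap.ext h)
  have : LinearIndependent S (fun o : Option κ => o.elim v u) := by
    rw [Fintype.linearIndependent_iff] at hli ⊢
    intro c hc
    rw [Fintype.sum_option] at hc
    have h1 := congrArg φ hc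
    simp [hu, hv] at h1
    simp [h1] at hc
    have h2 := hli _ hc
    rintro (_ | k)
    · exact h1
    · exact h2 k
  have := this.fintype_card_le_finrank
  simpa using this

theorem comp_X_mul (i : Fin 3) (k : ℕ) (a : S) :
    homogeneousComponent (k + 1) (X i * a) = X i * homogeneousComponent k a := by
  ext m
  rw [coeff_homogeneousComponent, coeff_X_mul', coeff_X_mul', coeff_homogeneousComponent]
  by_cases h : i ∈ m.support
  · have hle : Finsupp.single i 1 ≤ m := by
      rw [Finsupp.single_le_iff]
      exact Nat.one_le_iff_ne_zero.2 (Finsupp.mem_support_iff.1 h)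
    have hd : m.degree = (m - Finsupp.single i 1).degree + 1 := by
      conv_lhs => rw [← tsub_add_cancel_of_le hle]
      rw [map_add, Finsupp.degree_single]
    simp only [h, if_true, hd, Nat.add_right_cancel_iff]
  · simp [h]

theorem comp_zero_X_mul (i : Fin 3) (a : S) :
    homogeneousComponent 0 (X i * a) = 0 := by
  rw [homogeneousComponent_zero]
  have : coeff 0 (X i * a) = 0 := by rw [coeff_X_mul']; simp
  rw [this, C_0]

theorem comp_mul_hom (e : S) (i k : ℕ) (he : e.IsHomogeneous i) (b : S) :
    homogeneousComponent (k + i) (b * e) = homogeneousComponent k b * e := by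
  conv_lhs => rw [← sum_homogeneousComponent b, Finset.sum_mul, map_sum]
  have : ∀ j ∈ Finset.range (b.totalDegree + 1),
      homogeneousComponent (k + i) (homogeneousComponent j b * e) =
        if j = k then homogeneousComponent k b * e else 0 := by
    intro j _
    have hh : (homogeneousComponent j b * e).IsHomogeneous (j + i) :=
      (homogeneousComponent_isHomogeneous j b).mul he
    rw [homogeneousComponent_of_mem hh]
    by_cases hjk : j = k
    · subst hjk; simp
    · rw [if_neg, if_neg hjk]; omega
  rw [Finset.sum_congr rfl this, Finset.sum_ite_eq']
  split_ifs with h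
  · rfl
  · rw [homogeneousComponent_eq_zero, zero_mul]
    simpa using h

theorem comp_mul_hom_lt (e : S) (i n : ℕ) (hn : n < i) (he : e.IsHomogeneous i) (b : S) :
    homogeneousComponent n (b * e) = 0 := by
  conv_lhs => rw [← sum_homogeneousComponent b, Finset.sum_mul, map_sum]
  refine Finset.sum_eq_zero fun j _ => ?_
  have hh : (homogeneousComponent j b * e).IsHomogeneous (j + i) :=
      (homogeneousComponent_isHomogeneous j b).mul he
  rw [homogeneousComponent_of_mem hh, if_neg]
  omega

theorem mem_mId_mul (I : Ideal S) (w : S) (hw : w ∈ mId * I) :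
    ∃ a b c : S, a ∈ I ∧ b ∈ I ∧ c ∈ I ∧ w = X 0 * a + X 1 * b + X 2 * c := by
  have : mId = Ideal.span {X 0} ⊔ (Ideal.span {X 1} ⊔ Ideal.span {X 2}) := by
    rw [mId, Ideal.span_insert, Ideal.span_insert]
  rw [this, Ideal.sup_mul, Ideal.sup_mul] at hw
  obtain ⟨p, hp, q, hq, rfl⟩ := Submodule.mem_sup.1 hw
  obtain ⟨q', hq', r, hr, rfl⟩ := Submodule.mem_sup.1 hq
  obtain ⟨a, ha, rfl⟩ := Ideal.mem_span_singleton_mul.1 hp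
  obtain ⟨b, hb, rfl⟩ := Ideal.mem_span_singleton_mul.1 hq'
  obtain ⟨c, hc, rfl⟩ := Ideal.mem_span_singleton_mul.1 hr
  exact ⟨a, b, c, ha, hb, hc, by ring⟩

theorem xyz_mem (I : Ideal S) (a b c : S) (ha : a ∈ I) (hb : b ∈ I) (hc : c ∈ I) :
    X 0 * a + X 1 * b + X 2 * c ∈ mId * I :=
  add_mem (add_mem (Ideal.mul_mem_mul (X_mem_mId 0) ha) (Ideal.mul_mem_mul (X_mem_mId 1) hb))
    (Ideal.mul_mem_mul (X_mem_mId 2) hc)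

theorem hom_succ_dec (s : S) (j : ℕ) (hs : s.IsHomogeneous (j + 1)) :
    ∃ a b c : S, a.IsHomogeneous j ∧ b.IsHomogeneous j ∧ c.IsHomogeneous j ∧
      s = X 0 * a + X 1 * b + X 2 * c := by
  have h1 : s ∈ mId * ⊤ := by
    rw [Ideal.mul_top, mem_mId_iff]
    by_contra h
    have := hs h
    simp at this
  obtain ⟨a, b, c, -, -, -, e⟩ := mem_mId_mul _ _ h1
  refine ⟨_, _, _, homogeneousComponent_isHomogeneous j a, homogeneousComponent_isHomogeneous j b,
    homogeneousComponent_isHomogeneous j c, ?_⟩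
  rw [← homogeneousComponent_eq_self hs, e, map_add, map_add, comp_X_mul, comp_X_mul, comp_X_mul]

/-- Homogeneous ideal. -/
def HomI (I : Ideal S) : Prop := ∀ p ∈ I, ∀ n, homogeneousComponent n p ∈ I

theorem structure_thm (I J : Ideal S) (hI : HomI I) (hJ : HomI J) (hJI : J ≤ I)
    (hdim : ∀ (k : ℕ) (g h : S), g ∈ I → h ∈ I → g.IsHomogeneous k → h.IsHomogeneous k →
      h ∉ J → ∃ l : ℂ, g - C l * h ∈ J) :
    ∃ (D : Finset ℕ) (e : ℕ → S), (∀ k ∈ D, e k ∈ I ∧ e k ∉ J) ∧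
      I = J ⊔ Ideal.span (e '' D) ∧
      ∀ b : ℕ → S, ∑ k ∈ D, b k * e k ∈ J → ∀ k ∈ D, b k * e k ∈ J := by
  classical
  let D' : Set ℕ := {k | ∃ h ∈ I, h.IsHomogeneous k ∧ h ∉ J ⊔ mId * I}
  have hex : ∀ k, ∃ h : S, k ∈ D' → h ∈ I ∧ h.IsHomogeneous k ∧ h ∉ J ⊔ mId * I := by
    intro k
    by_cases hk : k ∈ D'
    · obtain ⟨h, h1, h2, h3⟩ := hk
      exact ⟨h, fun _ => ⟨h1, h2, h3⟩⟩
    · exact ⟨0, fun h => absurd h hk⟩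
  choose e he using hex
  have heJ : ∀ k ∈ D', e k ∉ J := fun k hk h => (he k hk).2.2 (Ideal.mem_sup_left h)
  have hmI : mId * I ≤ I := Ideal.mul_le_right
  have hkill : ∀ k ∈ D', ∀ g ∈ mId * I, g.IsHomogeneous k → g ∈ J := by
    intro k hk g hg hgk
    by_contra hgJ
    obtain ⟨l, hl⟩ := hdim k (e k) g (he k hk).1 (hmI hg) (he k hk).2.1 hgk hgJ
    apply (he k hk).2.2
    have := add_mem (Ideal.mem_sup_left (T := mId * I) hl)
      (Ideal.mem_sup_right (S := J) (Ideal.mul_mem_left _ (C l) hg))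
    simpa using this
  have hgen : ∀ k : ℕ, ∀ h ∈ I, h.IsHomogeneous k → h ∈ J ⊔ Ideal.span (e '' D') := by
    intro k
    induction k with
    | zero =>
      intro h hh hk
      by_cases hD : 0 ∈ D'
      · obtain ⟨l, hl⟩ := hdim 0 h (e 0) hh (he 0 hD).1 hk (he 0 hD).2.1 (heJ 0 hD)
        have := add_mem (Ideal.mem_sup_left (T := Ideal.span (e '' D')) hl)
          (Ideal.mem_sup_right (S := J) (Ideal.mul_mem_left _ (C l)
            (Ideal.subset_span (Set.mem_image_of_mem e hD))))
        simpa using this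
      · have : h ∈ J ⊔ mId * I := by
          by_contra hc
          exact hD ⟨h, hh, hk, hc⟩
        obtain ⟨j, hj, w, hw, rfl⟩ := Submodule.mem_sup.1 this
        obtain ⟨a, b, c, ha, hb, hc, rfl⟩ := mem_mId_mul _ _ hw
        apply Ideal.mem_sup_left
        rw [← homogeneousComponent_eq_self hk]
        simp only [map_add, comp_zero_X_mul, add_zero]
        exact hJ _ hj _
    | succ k ih =>
      intro h hh hk
      by_cases hD : (k + 1) ∈ D'
      · obtain ⟨l, hl⟩ := hdim _ h (e _) hh (he _ hD).1 hk (he _ hD).2.1 (heJ _ hD)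
        have := add_mem (Ideal.mem_sup_left (T := Ideal.span (e '' D')) hl)
          (Ideal.mem_sup_right (S := J) (Ideal.mul_mem_left _ (C l)
            (Ideal.subset_span (Set.mem_image_of_mem e hD))))
        simpa using this
      · have : h ∈ J ⊔ mId * I := by
          by_contra hc
          exact hD ⟨h, hh, hk, hc⟩
        obtain ⟨j, hj, w, hw, rfl⟩ := Submodule.mem_sup.1 this
        obtain ⟨a, b, c, ha, hb, hc, rfl⟩ := mem_mId_mul _ _ hw
        rw [← homogeneousComponent_eq_self hk]
        simp only [map_add, comp_X_mul]
        have q : ∀ a ∈ I, homogeneousComponent k a ∈ J ⊔ Ideal.span (e '' D') := fun a ha =>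
          ih _ (hI a ha k) (homogeneousComponent_isHomogeneous _ _)
        exact add_mem (Ideal.mem_sup_left (hJ _ hj _)) (add_mem (add_mem
          (Ideal.mul_mem_left _ _ (q a ha)) (Ideal.mul_mem_left _ _ (q b hb)))
          (Ideal.mul_mem_left _ _ (q c hc)))
  have hI' : I = J ⊔ Ideal.span (e '' D') := by
    apply le_antisymm
    · intro p hp
      rw [← sum_homogeneousComponent p]
      exact Submodule.sum_mem _ fun i _ => hgen i _ (hI p hp i) (homogeneousComponent_isHomogeneous _ _)
    · refine sup_le hJI ?_
      rw [Ideal.span_le]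
      rintro _ ⟨k, hk, rfl⟩
      exact (he k hk).1
  have hkill2 : ∀ i ∈ D', ∀ i' ∈ D', i < i' → ∀ j (s : S), s.IsHomogeneous j → i' ≤ j + i →
      s * e i ∈ J := by
    intro i hi i' hi' hii j
    induction j with
    | zero => intro s _ h; omega
    | succ j ih =>
      intro s hs hj
      obtain ⟨a, b, c, ha, hb, hc, rfl⟩ := hom_succ_dec s j hs
      by_cases hj' : i' ≤ j + i
      · have e1 : (X 0 * a + X 1 * b + X 2 * c) * e i =
            X 0 * (a * e i) + X 1 * (b * e i) + X 2 * (c * e i) := by ring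
        rw [e1]
        exact add_mem (add_mem (Ideal.mul_mem_left _ _ (ih a ha hj'))
          (Ideal.mul_mem_left _ _ (ih b hb hj'))) (Ideal.mul_mem_left _ _ (ih c hc hj'))
      · have e2 : i' = j + 1 + i := by omega
        apply hkill i' hi'
        · have := xyz_mem ⊤ a b c trivial trivial trivial
          rw [Ideal.mul_top] at this
          exact Ideal.mul_mem_mul this (he i hi).1
        · rw [e2]
          exact hs.mul (he i hi).2.1
  obtain ⟨T, hT, hTs⟩ := (Submodule.fg_span_iff_fg_span_finset_subset (R := S) (e '' D')).1
    (IsNoetherian.noetherian _)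
  obtain ⟨D, hD, rfl⟩ := Finset.subset_set_image_iff.1 hT
  refine ⟨D, e, fun k hk => ⟨(he k (hD hk)).1, heJ k (hD hk)⟩, ?_, ?_⟩
  · rw [Finset.coe_image] at hTs
    rw [hI', Ideal.span, hTs]
  · intro b hb k hk
    have claim : ∀ n, ∀ k ∈ D, homogeneousComponent n (b k * e k) ∈ J := by
      intro n k hk
      have hn := hJ _ hb n
      rw [map_sum] at hn
      by_contra hk'
      have others : ∀ i ∈ D, i ≠ k → homogeneousComponent n (b i * e i) ∈ J := by
        have small : ∀ i ∈ D, ∀ i' ∈ D, i < i' → i' ≤ n → homogeneousComponent n (b i * e i) ∈ J := by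
          intro i hi i' hi' h1 h2
          obtain ⟨r, rfl⟩ : ∃ r, n = r + i := ⟨n - i, by omega⟩
          rw [comp_mul_hom _ _ _ (he i (hD hi)).2.1]
          exact hkill2 i (hD hi) i' (hD hi') h1 r _ (homogeneousComponent_isHomogeneous _ _) h2
        intro i hi hik
        have hkn : k ≤ n := by
          by_contra h
          apply hk'
          rw [comp_mul_hom_lt _ _ _ (not_le.1 h) (he k (hD hk)).2.1]
          exact J.zero_mem
        by_cases hin : i ≤ n
        · rcases lt_or_gt_of_ne hik with h | h
          · exact small i hi k hk h hkn
          · exact absurd (small k hk i hi h hin) hk'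
        · rw [comp_mul_hom_lt _ _ _ (not_le.1 hin) (he i (hD hi)).2.1]
          exact J.zero_mem
      apply hk'
      rw [← Finset.add_sum_erase _ _ hk] at hn
      refine (Submodule.add_mem_iff_left _ (Submodule.sum_mem _ ?_)).1 hn
      intro i hi
      exact others i (Finset.mem_of_mem_erase hi) (Finset.ne_of_mem_erase hi)
    rw [← sum_homogeneousComponent (b k * e k)]
    exact Submodule.sum_mem _ fun n _ => claim n k hk

theorem colon_succ (J : Ideal S) (n : ℕ) (u : S) :
    u ∈ Submodule.colon J ((mId ^ (n + 1) : Ideal S) : Submodule S S) ↔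
    ∀ i, X i * u ∈ Submodule.colon J ((mId ^ n : Ideal S) : Submodule S S) := by
  constructor
  · intro h i
    rw [Submodule.mem_colon] at h ⊢
    intro s hs
    have := h (X i * s) (by
      rw [SetLike.mem_coe, pow_succ']
      exact Ideal.mul_mem_mul (X_mem_mId i) hs)
    simpa [mul_assoc, mul_left_comm] using this
  · intro h
    rw [Submodule.mem_colon]
    intro s hs
    rw [SetLike.mem_coe, pow_succ'] at hs
    obtain ⟨a, b, c, ha, hb, hc, rfl⟩ := mem_mId_mul _ _ hs
    have h0 := Submodule.mem_colon.1 (h 0) a ha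
    have h1 := Submodule.mem_colon.1 (h 1) b hb
    have h2 := Submodule.mem_colon.1 (h 2) c hc
    have := add_mem (add_mem h0 h1) h2
    simp only [smul_eq_mul] at this ⊢
    convert this using 1
    ring

theorem mem_Isat (f u : S) : u ∈ Isat f ↔
    ∃ n : ℕ, u ∈ Submodule.colon (Jf f) ((mId ^ n : Ideal S) : Submodule S S) := by
  rw [Isat, Submodule.mem_iSup_of_directed]
  apply Monotone.directed_le
  intro a b hab
  apply Submodule.colon_mono le_rfl
  exact Ideal.pow_le_pow_right hab

theorem Jf_le_Isat (f : S) : Jf f ≤ Isat f := by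
  intro u hu
  rw [mem_Isat]
  refine ⟨0, Submodule.mem_colon.2 fun s _ => ?_⟩
  exact Ideal.mul_mem_right _ _ hu

theorem Jf_hom (f : S) (d : ℕ) (hf : f.IsHomogeneous d) : HomI (Jf f) := by
  intro p hp n
  let _ := MvPolynomial.gradedAlgebra (σ := Fin 3) (R := ℂ)
  refine homogeneousComponent_mem_of_mem ?_ hp n
  apply Ideal.homogeneous_span
  rintro x (rfl | rfl | rfl) <;> exact ⟨d - 1, hf.pderiv⟩

theorem Isat_hom (f : S) (d : ℕ) (hf : f.IsHomogeneous d) : HomI (Isat f) := by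
  have : ∀ n : ℕ, HomI (Submodule.colon (Jf f) ((mId ^ n : Ideal S) : Submodule S S)) := by
    intro n
    induction n with
    | zero =>
      have : Submodule.colon (Jf f) ((mId ^ 0 : Ideal S) : Submodule S S) = Jf f := by
        ext u
        rw [Submodule.mem_colon]
        constructor
        · intro h
          simpa using h 1 (by simp)
        · intro h s _
          exact Ideal.mul_mem_right _ _ h
      rw [this]
      exact Jf_hom f d hf
    | succ n ih =>
      intro p hp k
      rw [colon_succ] at hp ⊢
      intro i
      rw [← comp_X_mul]
      exact ih _ (hp i) _
  intro p hp k
  rw [mem_Isat] at hp ⊢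
  obtain ⟨n, hn⟩ := hp
  exact ⟨n, this n p hn k⟩

theorem Isat_sat (f h : S) (hh : ∀ i, X i * h ∈ Isat f) : h ∈ Isat f := by
  have : ∀ i, ∃ n : ℕ, X i * h ∈ Submodule.colon (Jf f) ((mId ^ n : Ideal S) : Submodule S S) :=
    fun i => (mem_Isat _ _).1 (hh i)
  choose n hn using this
  rw [mem_Isat]
  refine ⟨(∑ i, n i) + 1, (colon_succ _ _ _).2 fun i => ?_⟩
  refine Submodule.colon_mono le_rfl ?_ (hn i)
  exact Ideal.pow_le_pow_right (Finset.single_le_sum (fun _ _ => Nat.zero_le _) (Finset.mem_univ i))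

theorem dim_use (f : S) (k : ℕ) (h1 : ndim f k ≤ 1) (g h : S) (hg : g ∈ Isat f) (hh : h ∈ Isat f)
    (hgk : g.IsHomogeneous k) (hhk : h.IsHomogeneous k) (hJ : h ∉ Jf f) :
    ∃ l : ℂ, g - C l * h ∈ Jf f := by
  have hfin : Module.Finite ℂ (Sgr k) := Module.Finite.iff_fg.2 (homogeneousSubmodule_fg _ _ k)
  have hfin2 : Module.Finite ℂ (((Isat f).restrictScalars ℂ ⊓ Sgr k : Submodule ℂ S)) :=
    Submodule.finiteDimensional_of_le inf_le_right
  have hfin3 : Module.Finite ℂ (Nsub f k) := Module.Finite.map _ _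
  obtain ⟨v, hv⟩ := finrank_le_one_iff.1 h1
  let G : Nsub f k := ⟨quotC f g, Submodule.mem_map_of_mem ⟨hg, hgk⟩⟩
  let H : Nsub f k := ⟨quotC f h, Submodule.mem_map_of_mem ⟨hh, hhk⟩⟩
  obtain ⟨a, ha⟩ := hv G
  obtain ⟨b, hb⟩ := hv H
  have hb0 : b ≠ 0 := by
    rintro rfl
    apply hJ
    have : quotC f h = 0 := by
      have := congrArg Subtype.val hb
      simpa [H] using this.symm
    exact (Submodule.Quotient.mk_eq_zero _).1 this
  refine ⟨a / b, ?_⟩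
  have : quotC f (g - (a / b) • h) = 0 := by
    rw [map_sub, map_smul]
    have e1 : quotC f g = a • (v : S ⧸ (Jf f : Submodule S S)) := (congrArg Subtype.val ha).symm
    have e2 : quotC f h = b • (v : S ⧸ (Jf f : Submodule S S)) := (congrArg Subtype.val hb).symm
    rw [e1, e2, smul_smul, div_mul_cancel₀ _ hb0, sub_self]
  rw [MvPolynomial.smul_eq_C_mul] at this
  exact (Submodule.Quotient.mk_eq_zero _).1 this

theorem mem_Jf (f u : S) : u ∈ Jf f ↔ ∃ a : Fin 3 → S, u = ∑ t, a t * pderiv t f := by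
  rw [Jf, Ideal.mem_span_insert]
  constructor
  · rintro ⟨a, z, hz, rfl⟩
    obtain ⟨b, c, rfl⟩ := Ideal.mem_span_pair.1 hz
    exact ⟨![a, b, c], by simp [Fin.sum_univ_three]; ring⟩
  · rintro ⟨a, rfl⟩
    exact ⟨a 0, a 1 * pderiv 1 f + a 2 * pderiv 2 f, Ideal.mem_span_pair.2 ⟨_, _, rfl⟩,
      by rw [Fin.sum_univ_three]; ring⟩

theorem card_le_one (f : S) (D : Finset ℕ) (e : ℕ → S)
    (he : ∀ k ∈ D, e k ∈ Isat f ∧ e k ∉ Jf f)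
    (hgen : Isat f = Jf f ⊔ Ideal.span (e '' D))
    (hdir : ∀ b : ℕ → S, ∑ k ∈ D, b k * e k ∈ Jf f → ∀ k ∈ D, b k * e k ∈ Jf f) :
    D.card ≤ 1 := by
  classical
  rcases D.eq_empty_or_nonempty with rfl | ⟨k0, hk0⟩
  · simp
  let g : Fin 3 ⊕ D → S := Sum.elim (fun t => pderiv t f) (fun k => e k)
  let φ : (Fin 3 ⊕ D → S) →ₗ[S] S := Fintype.linearCombination S g
  have hφ : ∀ c, φ c = ∑ t, c (Sum.inl t) * pderiv t f + ∑ k : D, c (Sum.inr k) * e k := by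
    intro c
    simp [φ, g, Fintype.linearCombination_apply]
  have hrange : LinearMap.range φ = Isat f := by
    rw [Fintype.range_linearCombination, hgen]
    simp only [g, Set.Sum.elim_range, Submodule.span_union]
    congr 1
    · ext u
      rw [mem_Jf, Submodule.mem_span_range_iff_exists_fun]
      simp [eq_comm]
    · congr 1
      ext u
      simp
  let A : D → Ideal S := fun k => Submodule.colon (Jf f) {e k}
  have mA : ∀ k c, c ∈ A k ↔ c * e k ∈ Jf f := by
    intro k c
    simp [A, Submodule.mem_colon_singleton]
  have hA : ∀ k, ∃ c : Fin 3 → S, (∀ j, c j ∈ A k) ∧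
      ∀ l : Fin 3 → ℂ, (∑ j, C (l j) * c j) ∈ mId * A k → l = 0 := by
    intro k
    obtain ⟨p, hp⟩ := (mem_Isat _ _).1 (he k k.2).1
    refine triple (A k) ?_ p ?_
    · intro h
      have := (mA k 1).1 (by rw [h]; trivial)
      rw [one_mul] at this
      exact (he k k.2).2 this
    · intro s hs
      rw [mA, mul_comm]
      exact Submodule.mem_colon.1 hp s hs
  choose c hc hcl using hA
  have hlift : ∀ k j, ∃ a : Fin 3 → S, c k j * e k = ∑ t, a t * pderiv t f := fun k j =>
    (mem_Jf _ _).1 ((mA _ _).1 (hc k j))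
  choose a ha using hlift
  let u : D × Fin 3 → (Fin 3 ⊕ D → S) := fun kj =>
    Sum.elim (fun t => - a kj.1 kj.2 t) (Pi.single kj.1 (c kj.1 kj.2))
  have hu : ∀ kj, φ (u kj) = 0 := by
    rintro ⟨k, j⟩
    rw [hφ]
    simp only [u, Sum.elim_inl, Sum.elim_inr, neg_mul, Finset.sum_neg_distrib]
    rw [← ha k j, Finset.sum_eq_single k]
    · simp
    · intro b _ hb
      simp [hb]
    · simp
  have hK : ∀ p, φ p = 0 → ∀ k : D, p (Sum.inr k) ∈ A k := by
    intro p hp k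
    rw [mA]
    have h1 := hdir (fun n => if h : n ∈ D then p (Sum.inr ⟨n, h⟩) else 0) ?_ k k.2
    · simpa using h1
    · rw [hφ] at hp
      rw [← Finset.sum_coe_sort]
      have e1 : ∑ i : D, (fun n => if h : n ∈ D then p (Sum.inr ⟨n, h⟩) else 0) (i : ℕ) * e i =
          ∑ k : D, p (Sum.inr k) * e k := by
        refine Finset.sum_congr rfl fun i _ => ?_
        simp
      rw [e1, mem_Jf]
      refine ⟨fun t => - p (Sum.inl t), ?_⟩
      simp only [neg_mul, Finset.sum_neg_distrib]
      linear_combination hp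
  have hli : LinearIndependent S u := by
    refine depth_indep φ ?_ u hu ?_
    · intro h hh
      rw [hrange] at hh ⊢
      exact Isat_sat f h hh
    · rintro l ⟨p, q, r, hp, hq, hr, E⟩
      have : ∀ k, (fun j => l (k, j)) = 0 := by
        intro k
        apply hcl k
        have E' := congrFun E (Sum.inr k)
        rw [Finset.sum_apply, Fintype.sum_prod_type, Finset.sum_eq_single k] at E'
        · simp only [u, Pi.smul_apply, Pi.add_apply, Sum.elim_inr, Pi.single_eq_same,
            smul_eq_mul] at E'
          rw [E']
          exact xyz_mem _ _ _ _ (hK p hp k) (hK q hq k) (hK r hr k)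
        · intro b _ hb
          refine Finset.sum_eq_zero fun j _ => ?_
          simp [u, hb.symm]
        · simp
      funext ⟨k, j⟩
      exact congrFun (this k) j
  have hne : φ ≠ 0 := by
    intro h
    have h1 : e k0 ∈ LinearMap.range φ := by rw [hrange]; exact (he k0 hk0).1
    rw [h] at h1
    simp at h1
    apply (he k0 hk0).2
    rw [h1]; exact zero_mem _
  have := card_bound φ hne u hu hli
  simp at this
  omega

theorem stmt1 (f : S) (d : ℕ) (hhom : f.IsHomogeneous d) (hred : Squarefree f)
    (hnc : ¬ IsConeOfLines f) (h1 : ∀ k : ℕ, ndim f k ≤ 1) :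
    ∃ e : S ⧸ (Jf f : Submodule S S), e ∈ Nmod f ∧ Submodule.span S {e} = Nmod f := by
  obtain ⟨D, e, he, hgen, hdir⟩ := structure_thm (Isat f) (Jf f) (Isat_hom f d hhom)
    (Jf_hom f d hhom) (Jf_le_Isat f)
    (fun k g h hg hh hgk hhk hJ => dim_use f k (h1 k) g h hg hh hgk hhk hJ)
  have hcard := card_le_one f D e he hgen hdir
  have key : ∃ w ∈ Isat f, Isat f = Jf f ⊔ Ideal.span {w} := by
    rw [Finset.card_le_one_iff_subset_singleton] at hcard
    obtain ⟨k, hk⟩ := hcard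
    rcases Finset.subset_singleton_iff.1 hk with rfl | rfl
    · refine ⟨0, zero_mem _, ?_⟩
      rw [hgen]; simp
    · refine ⟨e k, (he k (by simp)).1, ?_⟩
      rw [hgen]; simp
  obtain ⟨w, hw, hI⟩ := key
  have hspan : Submodule.span S {(Jf f : Submodule S S).mkQ w} = Nmod f := by
    unfold Nmod
    rw [hI, Submodule.map_sup, Ideal.span, Submodule.map_span, Set.image_singleton]
    simp
  exact ⟨(Jf f : Submodule S S).mkQ w, Submodule.mem_map_of_mem hw, hspan⟩

end
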